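/- Let d, n ≥ 1 and let ω ⊂ ℝ^d be a bounded measurable set of positive Lebesgue measure. There exists a constant C > 0, depending only on d and ω, with the following property. Let V : ℝ^d → M_n(ℂ) be measurable with Frobenius norm |V(x)| ≤ M almost everywhere, and let μ, η > 0. Then for every γ ∈ ℤ^d: | η^{−d} ∫_{□_γ^η} ( V(x) − (μ^d · mes ω)^{−1} ∫_{x + μω} V(y) dy ) dx | ≤ C M μ / η, where mes ω denotes the Lebesgue measure of ω and x + μω = { x + μz : z ∈ ω }. -/

import Mathlib

open MeasureTheory

noncomputable section

/-- `ℝ^d` with its Euclidean structure. -/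
abbrev Ed (d : ℕ) := EuclideanSpace ℝ (Fin d)

/-- The cell `□_γ^η = η•γ + [0,η]^d` of the rescaled lattice `ηℤ^d`. -/
def cell (d : ℕ) (η : ℝ) (γ : Fin d → ℤ) : Set (Ed d) :=
  {x | ∀ i, η * γ i ≤ x i ∧ x i ≤ η * γ i + η}

/-- Frobenius norm of a complex `n × n` matrix. -/
def frob {n : ℕ} (A : Matrix (Fin n) (Fin n) ℂ) : ℝ :=
  Real.sqrt (∑ i, ∑ k, ‖A i k‖ ^ 2)

lemma cell_eq (d : ℕ) (η : ℝ) (γ : Fin d → ℤ) :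
    cell d η γ = (MeasurableEquiv.toLp 2 (Fin d → ℝ)).symm ⁻¹'
      (Set.univ.pi fun i => Set.Icc (η * γ i) (η * γ i + η)) := by
  ext x
  simp only [cell, Set.mem_preimage, Set.mem_pi, Set.mem_univ, true_imp_iff]
  exact Iff.rfl

lemma cell_meas (d : ℕ) (η : ℝ) (γ : Fin d → ℤ) : MeasurableSet (cell d η γ) := by
  rw [cell_eq]
  exact (MeasurableEquiv.measurable _) (MeasurableSet.univ_pi fun i => measurableSet_Icc)

lemma cell_vol (d : ℕ) (η : ℝ) (γ : Fin d → ℤ) : volume (cell d η γ) < ⊤ := by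
  rw [cell_eq, (EuclideanSpace.volume_preserving_symm_measurableEquiv_toLp (Fin d)).measure_preimage_equiv,
    volume_pi_pi]
  exact ENNReal.prod_lt_top fun i _ => by simp

lemma cell_shift (d : ℕ) (η : ℝ) (hη : 0 < η) (γ : Fin d → ℤ) (v : Ed d) :
    volume {x | x ∈ cell d η γ ∧ x - v ∉ cell d η γ} ≤
      ENNReal.ofReal (d * (η ^ (d - 1) * ‖v‖)) := by
  classical
  set J : Fin d → Set ℝ := fun i => Set.Ico (η * γ i) (η * γ i + v i) ∪
    Set.Ioc (η * γ i + η + v i) (η * γ i + η) with hJ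
  set S : Fin d → Set (Ed d) := fun i => (MeasurableEquiv.toLp 2 (Fin d → ℝ)).symm ⁻¹'
      (Set.univ.pi (Function.update (fun i => Set.Icc (η * γ i) (η * γ i + η)) i (J i))) with hS
  have hsub : {x | x ∈ cell d η γ ∧ x - v ∉ cell d η γ} ⊆ ⋃ i, S i := by
    rintro x ⟨hx, hxv⟩
    simp only [cell, Set.mem_ofPred_eq, not_forall] at hx hxv
    obtain ⟨i, hi⟩ := hxv
    refine Set.mem_iUnion.2 ⟨i, ?_⟩
    simp only [hS, Set.mem_preimage, Set.mem_pi]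
    intro j _
    by_cases hj : j = i
    · subst hj
      simp only [Function.update_self, hJ, Set.mem_union, Set.mem_Ico, Set.mem_Ioc]
      have := hx j
      simp only [PiLp.sub_apply] at hi
      change (_ ≤ x j ∧ x j < _) ∨ (_ < x j ∧ x j ≤ _)
      by_contra hcon
      apply hi
      push Not at hcon
      constructor
      · linarith [hcon.1 this.1]
      · by_contra h
        push Not at h
        have := hcon.2 (by linarith)
        linarith
    · rw [Function.update_of_ne hj]
      exact hx j
  have hvol : ∀ i, volume (S i) ≤ ENNReal.ofReal (η ^ (d - 1) * ‖v‖) := by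
    intro i
    simp only [hS]
    rw [(EuclideanSpace.volume_preserving_symm_measurableEquiv_toLp (Fin d)).measure_preimage_equiv,
      volume_pi_pi, ← Finset.mul_prod_erase _ _ (Finset.mem_univ i)]
    have h1 : ∏ x ∈ Finset.univ.erase i, volume (Function.update
        (fun i => Set.Icc (η * (γ i : ℝ)) (η * γ i + η)) i (J i) x) = ENNReal.ofReal η ^ (d - 1) := by
      rw [Finset.prod_congr rfl (g := fun _ => ENNReal.ofReal η)]
      · simp
      · intro x hx
        rw [Function.update_of_ne (Finset.ne_of_mem_erase hx)]
        simp
    rw [h1, Function.update_self, mul_comm, ENNReal.ofReal_mul (by positivity),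
      ENNReal.ofReal_pow hη.le]
    gcongr
    refine (measure_union_le _ _).trans ?_
    rw [Real.volume_Ico, Real.volume_Ioc]
    have hv : |v i| ≤ ‖v‖ := by simpa using PiLp.norm_apply_le v i
    rcases le_total 0 (v i) with h | h
    · rw [ENNReal.ofReal_of_nonpos (p := η * ↑(γ i) + η - (η * ↑(γ i) + η + v i)) (by linarith), add_zero]
      apply ENNReal.ofReal_le_ofReal
      linarith [le_abs_self (v i)]
    · rw [ENNReal.ofReal_of_nonpos (p := η * ↑(γ i) + v i - η * ↑(γ i)) (by linarith), zero_add]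
      apply ENNReal.ofReal_le_ofReal
      linarith [neg_abs_le (v i)]
  calc _ ≤ volume (⋃ i, S i) := measure_mono hsub
    _ ≤ ∑ i, volume (S i) := measure_iUnion_fintype_le _ _
    _ ≤ ∑ i : Fin d, ENNReal.ofReal (η ^ (d - 1) * ‖v‖) := Finset.sum_le_sum fun i _ => hvol i
    _ = _ := by
      rw [ENNReal.ofReal_mul (p := (d : ℝ)) (by positivity), ENNReal.ofReal_natCast,
        Finset.sum_const, Finset.card_univ, Fintype.card_fin, nsmul_eq_mul]

section Gen
variable {F : Type*} [NormedAddCommGroup F] [NormedSpace ℝ F] [CompleteSpace F]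

lemma bdd_integrableOn {d : ℕ} {W : Ed d → F} (hW : StronglyMeasurable W) {M : ℝ}
    (hM : ∀ᵐ x, ‖W x‖ ≤ M) {s : Set (Ed d)} (hs : volume s < ⊤) : IntegrableOn W s := by
  have : IsFiniteMeasure (volume.restrict s) := ⟨by simpa using hs⟩
  exact Integrable.of_bound hW.aestronglyMeasurable M (ae_restrict_of_ae hM)

lemma shift_bound {d : ℕ} {W : Ed d → F} (hW : StronglyMeasurable W) {M : ℝ} (hM0 : 0 ≤ M)
    (hM : ∀ᵐ x, ‖W x‖ ≤ M) (η : ℝ) (hη : 0 < η) (γ : Fin d → ℤ) (v : Ed d) :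
    ‖∫ x in cell d η γ, (W x - W (x + v))‖ ≤ 2 * M * (d * (η ^ (d - 1) * ‖v‖)) := by
  have hmp : MeasurePreserving (fun x : Ed d => x + v) volume volume :=
    measurePreserving_add_right volume v
  have hemb : MeasurableEmbedding (fun x : Ed d => x + v) := measurableEmbedding_addRight v
  set Q := cell d η γ with hQ
  set Q' : Set (Ed d) := (fun x => x - v) ⁻¹' Q with hQ'
  have hQm : MeasurableSet Q := cell_meas d η γ
  have hQ'm : MeasurableSet Q' := (measurable_id.sub_const v) hQm
  have hpre : (fun x : Ed d => x + v) ⁻¹' Q' = Q := by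
    ext x; simp [hQ']
  have hQv : volume Q < ⊤ := cell_vol d η γ
  have hQ'v : volume Q' < ⊤ := by
    rw [← hmp.measure_preimage hQ'm.nullMeasurableSet, hpre]; exact hQv
  have hI := bdd_integrableOn hW hM hQv
  have hI' := bdd_integrableOn hW hM hQ'v
  have hIs : IntegrableOn (fun x => W (x + v)) Q := by
    rw [← hpre]
    exact (hmp.integrableOn_comp_preimage hemb).2 hI'
  have e1 : ∫ x in Q, W (x + v) = ∫ x in Q', W x := by
    rw [← hpre]
    exact hmp.setIntegral_preimage_emb hemb _ _
  rw [integral_sub hI hIs, e1, ← integral_inter_add_sdiff hQ'm hI, ← integral_inter_add_sdiff hQm hI',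
    Set.inter_comm Q' Q, add_sub_add_left_eq_sub]
  have b1 : volume (Q \ Q') ≤ ENNReal.ofReal (d * (η ^ (d - 1) * ‖v‖)) := cell_shift d η hη γ v
  have b2 : volume (Q' \ Q) ≤ ENNReal.ofReal (d * (η ^ (d - 1) * ‖v‖)) := by
    rw [← hmp.measure_preimage (hQ'm.diff hQm).nullMeasurableSet]
    have := cell_shift d η hη γ (-v)
    rw [norm_neg] at this
    refine le_trans (measure_mono ?_) this
    intro x hx
    simpa [hQ'] using hx
  have key : ∀ s : Set (Ed d), volume s ≤ ENNReal.ofReal (d * (η ^ (d - 1) * ‖v‖)) →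
      ‖∫ x in s, W x‖ ≤ M * (d * (η ^ (d - 1) * ‖v‖)) := by
    intro s hs
    refine (norm_setIntegral_le_of_norm_le_const_ae (hs.trans_lt ENNReal.ofReal_lt_top)
      (ae_restrict_of_ae hM)).trans ?_
    gcongr
    exact ENNReal.toReal_le_of_le_ofReal (by positivity) hs
  calc _ ≤ _ := norm_sub_le _ _
    _ ≤ _ := add_le_add (key _ b1) (key _ b2)
    _ = _ := by ring

lemma prod_integrable {d : ℕ} {W : Ed d → F} (hW : StronglyMeasurable W) {M : ℝ}
    (hM : ∀ᵐ x, ‖W x‖ ≤ M) {s t : Set (Ed d)} (hs : volume s < ⊤) (ht : volume t < ⊤) (μ : ℝ) :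
    Integrable (fun p : Ed d × Ed d => W (p.2 + μ • p.1))
      ((volume.restrict t).prod (volume.restrict s)) := by
  have : IsFiniteMeasure (volume.restrict s) := ⟨by simpa using hs⟩
  have : IsFiniteMeasure (volume.restrict t) := ⟨by simpa using ht⟩
  have hm : StronglyMeasurable (fun p : Ed d × Ed d => W (p.2 + μ • p.1)) :=
    hW.comp_measurable (by fun_prop)
  refine Integrable.of_bound hm.aestronglyMeasurable M ?_
  rw [Measure.ae_prod_iff_ae_ae (measurableSet_le hm.norm.measurable measurable_const)]
  refine Filter.Eventually.of_forall fun z => ae_restrict_of_ae ?_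
  exact (measurePreserving_add_right volume (μ • z)).quasiMeasurePreserving.ae hM

open scoped Pointwise in
lemma image_integral {d : ℕ} (W : Ed d → F) (ω : Set (Ed d)) (μ : ℝ) (hμ : 0 < μ) (x : Ed d) :
    ∫ y in (fun z => x + μ • z) '' ω, W y = μ ^ d • ∫ z in ω, W (x + μ • z) := by
  have h1 := Measure.setIntegral_comp_smul_of_pos (volume : Measure (Ed d)) (fun y => W (x + y)) ω hμ
  have h2 : (fun z => x + μ • z) '' ω = (fun y => x + y) '' (μ • ω) := by
    rw [← Set.image_smul, Set.image_image]
  rw [h1, h2, (measurePreserving_add_left volume x).setIntegral_image_emb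
    (measurableEmbedding_addLeft x), finrank_euclideanSpace, Fintype.card_fin, smul_smul,
    mul_inv_cancel₀ (by positivity), one_smul]

lemma gen_int {d : ℕ} {W : Ed d → F} (hW : StronglyMeasurable W) {M : ℝ}
    (hM : ∀ᵐ x, ‖W x‖ ≤ M) {ω : Set (Ed d)} (hω : volume ω < ⊤) (μ η : ℝ) (hμ : 0 < μ)
    (γ : Fin d → ℤ) (c : ℝ) :
    IntegrableOn (fun x => c • ∫ y in (fun z => x + μ • z) '' ω, W y) (cell d η γ) := by
  simp_rw [image_integral W ω μ hμ]
  exact ((prod_integrable hW hM (cell_vol d η γ) hω μ).integral_prod_right.smul _).smul _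

lemma gen_bound {d : ℕ} {W : Ed d → F} (hW : StronglyMeasurable W) {M : ℝ} (hM0 : 0 ≤ M)
    (hM : ∀ᵐ x, ‖W x‖ ≤ M) {ω : Set (Ed d)} (hωm : MeasurableSet ω)
    (hω : volume ω < ⊤) (hω0 : 0 < volume ω)
    {R : ℝ} (hR : ∀ z ∈ ω, ‖z‖ ≤ R) (μ η : ℝ) (hμ : 0 < μ) (hη : 0 < η)
    (γ : Fin d → ℤ) :
    ‖∫ x in cell d η γ, (W x - (μ ^ d * (volume ω).toReal)⁻¹ •
      ∫ y in (fun z => x + μ • z) '' ω, W y)‖ ≤ 2 * M * (d * (η ^ (d - 1) * (μ * R))) := by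
  have hv : 0 < (volume ω).toReal := ENNReal.toReal_pos hω0.ne' hω.ne
  have hQ := cell_vol d η γ
  have hI := bdd_integrableOn hW hM hQ
  have hP := prod_integrable hW hM hQ hω μ
  have hFin : IsFiniteMeasure (volume.restrict ω) := ⟨by simpa using hω⟩
  have e : ∫ x in cell d η γ, (W x - (μ ^ d * (volume ω).toReal)⁻¹ •
      ∫ y in (fun z => x + μ • z) '' ω, W y) =
      (volume ω).toReal⁻¹ • ∫ z in ω, ∫ x in cell d η γ, (W x - W (x + μ • z)) := by
    have hae : ∀ᵐ z ∂(volume.restrict ω), ∫ x in cell d η γ, (W x - W (x + μ • z)) =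
        (∫ x in cell d η γ, W x) - ∫ x in cell d η γ, W (x + μ • z) := by
      filter_upwards [hP.prod_right_ae] with z hz
      exact integral_sub hI hz
    rw [integral_sub hI (gen_int hW hM hω μ η hμ γ _), integral_congr_ae hae,
      integral_sub (integrable_const _) hP.integral_prod_left, integral_const, smul_sub,
      smul_smul, integral_integral_swap hP]
    simp_rw [image_integral W ω μ hμ, smul_smul]
    rw [integral_smul]
    congr 1
    · simp [Measure.real, hv.ne']
    · congr 1
      field_simp
  rw [e, norm_smul, norm_inv, Real.norm_of_nonneg hv.le]
  have hb : ‖∫ z in ω, ∫ x in cell d η γ, (W x - W (x + μ • z))‖ ≤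
      (2 * M * (d * (η ^ (d - 1) * (μ * R)))) * volume.real ω := by
    refine norm_setIntegral_le_of_norm_le_const hω fun z hz => ?_
    refine (shift_bound hW hM0 hM η hη γ (μ • z)).trans ?_
    rw [norm_smul, Real.norm_of_nonneg hμ.le]
    have := hR z hz
    gcongr
  rw [inv_mul_le_iff₀ hv, mul_comm]
  exact hb

end Gen

lemma frob_eq {n : ℕ} (A : Matrix (Fin n) (Fin n) ℂ) :
    frob A = ‖(WithLp.toLp 2 (fun p : Fin n × Fin n => A p.1 p.2) :
      EuclideanSpace ℂ (Fin n × Fin n))‖ := by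
  rw [EuclideanSpace.norm_eq, frob, Fintype.sum_prod_type]

/-- The comparison estimate (4.8) in the proof of Theorem 2.5, on
`Ω = ℝ^d`: replacing a bounded measurable matrix function `V` by its local averages
over the translated scaled sets `x + μω` changes the average over any cell `□_γ^η`
by at most `C M μ / η`, with `C` depending only on `d` and `ω`. -/
theorem stmt_6 (d : ℕ) (hd : 1 ≤ d)
    (ω : Set (Ed d)) (hωmeas : MeasurableSet ω) (hωbdd : Bornology.IsBounded ω)
    (hωpos : 0 < volume ω) :
    ∃ C : ℝ, 0 < C ∧
      ∀ (n : ℕ), 1 ≤ n →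
      ∀ (M : ℝ) (V : Ed d → Matrix (Fin n) (Fin n) ℂ),
        (∀ p q, Measurable fun x => V x p q) →
        (∀ᵐ x, frob (V x) ≤ M) →
        ∀ (μ η : ℝ), 0 < μ → 0 < η →
        ∀ γ : Fin d → ℤ,
          frob (fun p q => ((η : ℂ) ^ d)⁻¹ *
              ∫ x in cell d η γ,
                (V x p q - ((μ : ℂ) ^ d * ((volume ω).toReal : ℂ))⁻¹ *
                  ∫ y in (fun z => x + μ • z) '' ω, V y p q))
            ≤ C * M * μ / η := by
  obtain ⟨R, hR0, hR⟩ := hωbdd.exists_pos_norm_le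
  have hωtop : volume ω < ⊤ := hωbdd.measure_lt_top
  have hd0 : (0 : ℝ) < d := by exact_mod_cast hd
  refine ⟨2 * d * R, by positivity, ?_⟩
  intro n hn M V hVm hVM μ η hμ hη γ
  have hM0 : 0 ≤ M := by
    obtain ⟨x, hx⟩ := hVM.exists
    exact (Real.sqrt_nonneg _).trans hx
  set W : Ed d → EuclideanSpace ℂ (Fin n × Fin n) :=
    fun x => WithLp.toLp 2 (fun p => V x p.1 p.2) with hWdef
  have hWs : StronglyMeasurable W := by
    apply Measurable.stronglyMeasurable
    exact (MeasurableEquiv.toLp 2 (Fin n × Fin n → ℂ)).measurable.comp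
      (measurable_pi_lambda _ fun p => hVm p.1 p.2)
  have hWM : ∀ᵐ x, ‖W x‖ ≤ M := by
    filter_upwards [hVM] with x hx
    rwa [frob_eq] at hx
  have hcs : ∀ p : Fin n × Fin n, StronglyMeasurable (fun x => W x p) :=
    fun p => (hVm p.1 p.2).stronglyMeasurable
  have hcM : ∀ p : Fin n × Fin n, ∀ᵐ x, ‖W x p‖ ≤ M := fun p => by
    filter_upwards [hWM] with x hx
    exact (PiLp.norm_apply_le (W x) p).trans hx
  have himg : ∀ x : Ed d, volume ((fun z => x + μ • z) '' ω) < ⊤ := by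
    intro x
    have hb : Bornology.IsBounded ((fun z => x + μ • z) '' ω) := by
      refine isBounded_iff_forall_norm_le.2 ⟨‖x‖ + μ * R, ?_⟩
      rintro _ ⟨z, hz, rfl⟩
      refine (norm_add_le _ _).trans ?_
      rw [norm_smul, Real.norm_of_nonneg hμ.le]
      have := hR z hz
      gcongr
    exact hb.measure_lt_top
  have main := gen_bound hWs hM0 hWM hωmeas hωtop hωpos hR μ η hμ hη γ
  set c : ℝ := (μ ^ d * (volume ω).toReal)⁻¹ with hc
  have hinner : ∀ (x : Ed d) (p : Fin n × Fin n),
      (W x - c • ∫ y in (fun z => x + μ • z) '' ω, W y) p =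
      W x p - c • ∫ y in (fun z => x + μ • z) '' ω, W y p := by
    intro x p
    rw [PiLp.sub_apply, PiLp.smul_apply,
      eval_integral_piLp (fun q => bdd_integrableOn (hcs q) (hcM q) (himg x))]
  have heq : (WithLp.toLp 2 (fun p : Fin n × Fin n => ((η : ℂ) ^ d)⁻¹ *
              ∫ x in cell d η γ,
                (V x p.1 p.2 - ((μ : ℂ) ^ d * ((volume ω).toReal : ℂ))⁻¹ *
                  ∫ y in (fun z => x + μ • z) '' ω, V y p.1 p.2)) :
      EuclideanSpace ℂ (Fin n × Fin n)) = (η ^ d)⁻¹ • ∫ x in cell d η γ, (W x - c •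
      ∫ y in (fun z => x + μ • z) '' ω, W y) := by
    ext p
    rw [PiLp.smul_apply, eval_integral_piLp]
    · simp_rw [hinner]
      simp only [hc, hWdef, Complex.real_smul]
      push_cast
      rfl
    · intro q
      simp_rw [hinner]
      exact (bdd_integrableOn (hcs q) (hcM q) (cell_vol d η γ)).sub
        (gen_int (hcs q) (hcM q) hωtop μ η hμ γ c)
  refine ((frob_eq _).trans (congrArg norm heq)).trans_le ?_
  rw [norm_smul, norm_inv, norm_pow, Real.norm_of_nonneg hη.le,
    inv_mul_le_iff₀ (by positivity)]
  refine main.trans (le_of_eq ?_)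
  obtain ⟨k, rfl⟩ : ∃ k, d = k + 1 := ⟨d - 1, by omega⟩
  rw [Nat.add_sub_cancel, pow_succ]
  field_simp

end
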